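/- arXiv:2601.16014 — 2 statements merged into one kernel-verified Lean document; each statement's English description precedes it below -/
import Mathlib

section
/- Let p, q ∈ ℝ, let M be the 2×2 real matrix with rows (p, q) and (−q, p), let v_min > 0, and let v₁, v₂ ∈ ℝ² (Euclidean) with ‖v₁‖ ≥ v_min and ‖v₂‖ ≥ v_min. Then ‖(1/‖v₂‖²)·M v₂ − (1/‖v₁‖²)·M v₁‖ ≤ (√(p² + q²)/v_min²)·‖v₂ − v₁‖. -/
open Matrix

lemma cpl_norm_apply (p q : ℝ) (w : EuclideanSpace ℝ (Fin 2)) :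
    ‖Matrix.toEuclideanLin (!![p, q; -q, p]) w‖ = Real.sqrt (p ^ 2 + q ^ 2) * ‖w‖ := by
  rw [EuclideanSpace.norm_eq, EuclideanSpace.norm_eq, ← Real.sqrt_mul (by positivity)]
  congr 1
  simp [Fin.sum_univ_two, Matrix.toLpLin_apply, Matrix.mulVec, dotProduct]
  ring

lemma cpl_norm_inv (x y : EuclideanSpace ℝ (Fin 2)) (hx : x ≠ 0) (hy : y ≠ 0) :
    ‖(1 / ‖y‖ ^ 2) • y - (1 / ‖x‖ ^ 2) • x‖ = 1 / (‖y‖ * ‖x‖) * ‖y - x‖ := by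
  have h := EuclideanGeometry.dist_inversion_inversion hy hx 1
  simpa [EuclideanGeometry.inversion, dist_eq_norm] using h

/-- Incremental gain bound of Lemma 1: the constant power load map
`v ↦ M v / ‖v‖²` with `M = [[p, q], [-q, p]]` has incremental gain at most
`√(p² + q²) / v_min²` on voltages of norm at least `v_min`. -/
theorem cpl_incremental_gain (p q : ℝ) (vmin : ℝ) (hvmin : 0 < vmin)
    (v₁ v₂ : EuclideanSpace ℝ (Fin 2)) (h₁ : vmin ≤ ‖v₁‖) (h₂ : vmin ≤ ‖v₂‖) :
    ‖(1 / ‖v₂‖ ^ 2) • Matrix.toEuclideanLin (!![p, q; -q, p]) v₂ -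
        (1 / ‖v₁‖ ^ 2) • Matrix.toEuclideanLin (!![p, q; -q, p]) v₁‖ ≤
      (Real.sqrt (p ^ 2 + q ^ 2) / vmin ^ 2) * ‖v₂ - v₁‖ := by
  have p1 : 0 < ‖v₁‖ := hvmin.trans_le h₁
  have p2 : 0 < ‖v₂‖ := hvmin.trans_le h₂
  rw [← map_smul, ← map_smul, ← map_sub, cpl_norm_apply,
    cpl_norm_inv _ _ (norm_pos_iff.mp p1) (norm_pos_iff.mp p2), ← mul_assoc, mul_one_div]
  have : vmin ^ 2 ≤ ‖v₂‖ * ‖v₁‖ := by nlinarith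
  gcongr
end

section
/- Let p, q ∈ ℝ, let M be the 2×2 real matrix with rows (p, q) and (−q, p), let v₀ ∈ ℝ² (Euclidean) with V₀ := ‖v₀‖ > 0, and let v_δ ∈ ℝ². Define ξ := (2⟪v₀, v_δ⟫ + ‖v_δ‖²)/V₀² and suppose |ξ| < 1, and set v := v₀ + v_δ. Then v ≠ 0 and the nonlinear remainder i_har := (1/‖v‖²)·M v − (1/V₀²)·M v satisfies ‖i_har‖ ≤ (√(p² + q²)/V₀²) · (|ξ|/(1 − |ξ|)) · ‖v‖. -/
open Matrix
open scoped RealInnerProductSpace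

theorem cpl_norm_M (p q : ℝ) (v : EuclideanSpace ℝ (Fin 2)) :
    ‖Matrix.toEuclideanLin (!![p, q; -q, p]) v‖ = Real.sqrt (p ^ 2 + q ^ 2) * ‖v‖ := by
  rw [EuclideanSpace.norm_eq, EuclideanSpace.norm_eq, ← Real.sqrt_mul (by positivity)]
  congr 1
  simp [Fin.sum_univ_two, Matrix.toLpLin_apply, dotProduct]
  ring

/-- Intermediate geometric-series bound in the proof of Lemma 2: with `v = v₀ + v_δ`,
`V₀ = ‖v₀‖ > 0`, `ξ = (2⟪v₀, v_δ⟫ + ‖v_δ‖²)/V₀²` and `|ξ| < 1`, the nonlinear remainder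
`i_har = M v/‖v‖² − M v/V₀²` of the constant power load current satisfies
`‖i_har‖ ≤ (√(p²+q²)/V₀²) · (|ξ|/(1−|ξ|)) · ‖v‖`. -/
theorem cpl_remainder_geometric_bound (p q : ℝ)
    (v₀ vδ : EuclideanSpace ℝ (Fin 2)) (hv₀ : 0 < ‖v₀‖)
    (hξ : |(2 * ⟪v₀, vδ⟫ + ‖vδ‖ ^ 2) / ‖v₀‖ ^ 2| < 1) :
    v₀ + vδ ≠ 0 ∧
    ‖(1 / ‖v₀ + vδ‖ ^ 2) • Matrix.toEuclideanLin (!![p, q; -q, p]) (v₀ + vδ) -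
        (1 / ‖v₀‖ ^ 2) • Matrix.toEuclideanLin (!![p, q; -q, p]) (v₀ + vδ)‖ ≤
      (Real.sqrt (p ^ 2 + q ^ 2) / ‖v₀‖ ^ 2) *
        (|(2 * ⟪v₀, vδ⟫ + ‖vδ‖ ^ 2) / ‖v₀‖ ^ 2| /
          (1 - |(2 * ⟪v₀, vδ⟫ + ‖vδ‖ ^ 2) / ‖v₀‖ ^ 2|)) * ‖v₀ + vδ‖ := by
  have hn : ‖v₀ + vδ‖ ^ 2 = ‖v₀‖ ^ 2 * (1 + (2 * ⟪v₀, vδ⟫ + ‖vδ‖ ^ 2) / ‖v₀‖ ^ 2) := by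
    rw [norm_add_sq_real]
    field_simp
    ring
  generalize (2 * ⟪v₀, vδ⟫ + ‖vδ‖ ^ 2) / ‖v₀‖ ^ 2 = ξ at hξ hn ⊢
  have h1 : 0 < 1 - |ξ| := by linarith
  have h2 : 1 - |ξ| ≤ 1 + ξ := by linarith [neg_abs_le ξ]
  have h3 : 0 < 1 + ξ := by linarith
  refine ⟨?_, ?_⟩
  · intro h
    rw [h, norm_zero] at hn
    have : 0 < ‖v₀‖ ^ 2 * (1 + ξ) := by positivity
    linarith
  · rw [← sub_smul, norm_smul, cpl_norm_M, Real.norm_eq_abs, hn]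
    have e : 1 / (‖v₀‖ ^ 2 * (1 + ξ)) - 1 / ‖v₀‖ ^ 2 = (1 / ‖v₀‖ ^ 2) * (-ξ / (1 + ξ)) := by
      field_simp
      ring
    have hb : |ξ| / (1 + ξ) ≤ |ξ| / (1 - |ξ|) :=
      div_le_div_of_nonneg_left (abs_nonneg _) h1 h2
    rw [e, abs_mul, abs_div (-ξ), abs_neg, abs_of_pos h3,
      abs_of_pos (show 0 < 1 / ‖v₀‖ ^ 2 by positivity)]
    calc 1 / ‖v₀‖ ^ 2 * (|ξ| / (1 + ξ)) * (Real.sqrt (p ^ 2 + q ^ 2) * ‖v₀ + vδ‖)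
        ≤ 1 / ‖v₀‖ ^ 2 * (|ξ| / (1 - |ξ|)) * (Real.sqrt (p ^ 2 + q ^ 2) * ‖v₀ + vδ‖) := by
          gcongr
      _ = _ := by ring
end
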